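/- The left divisors of the Garside element Δ_n in the positive braid monoid B_n⁺ (the permutation braids) are in bijective correspondence with the symmetric group Σ_n: the monoid homomorphism π : B_n⁺ → Σ_n determined by σ_i ↦ (the transposition (i, i+1)) restricts to a bijection from the set {p ∈ B_n⁺ : p·q = Δ_n for some q ∈ B_n⁺} onto Σ_n; in particular Δ_n has exactly n! left divisors in B_n⁺. -/

import Mathlib

/-- The set of relators for Artin's classical presentation of the braid group `Bₙ`:
generators `σ₁, …, σ_{n-1}` (indexed by `Fin (n-1)`), with relations
`σᵢ σₖ = σₖ σᵢ` when `|i - k| ≥ 2` and `σᵢ σ_{i+1} σᵢ = σ_{i+1} σᵢ σ_{i+1}`. -/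
def braidRels (n : ℕ) : Set (FreeGroup (Fin (n - 1))) :=
  {w | (∃ i k : Fin (n - 1), (i : ℕ) + 2 ≤ (k : ℕ) ∧
          w = FreeGroup.of i * FreeGroup.of k * (FreeGroup.of k * FreeGroup.of i)⁻¹) ∨
       (∃ i k : Fin (n - 1), (i : ℕ) + 1 = (k : ℕ) ∧
          w = FreeGroup.of i * FreeGroup.of k * FreeGroup.of i *
              (FreeGroup.of k * FreeGroup.of i * FreeGroup.of k)⁻¹)}

/-- The braid group `Bₙ`, given by Artin's classical presentation. -/
abbrev BraidGroup (n : ℕ) : Type := PresentedGroup (braidRels n)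

/-- The defining relations of the positive braid monoid `Bₙ⁺`:
`σᵢ σₖ = σₖ σᵢ` for `|i-k| ≥ 2` and `σᵢ σ_{i+1} σᵢ = σ_{i+1} σᵢ σ_{i+1}`,
as a relation on the free monoid on `σ₁, …, σ_{n-1}`. -/
inductive BraidMonoidRel (n : ℕ) :
    FreeMonoid (Fin (n - 1)) → FreeMonoid (Fin (n - 1)) → Prop
  | comm (i k : Fin (n - 1)) (h : (i : ℕ) + 2 ≤ (k : ℕ)) :
      BraidMonoidRel n (FreeMonoid.of i * FreeMonoid.of k)
        (FreeMonoid.of k * FreeMonoid.of i)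
  | braid (i k : Fin (n - 1)) (h : (i : ℕ) + 1 = (k : ℕ)) :
      BraidMonoidRel n (FreeMonoid.of i * FreeMonoid.of k * FreeMonoid.of i)
        (FreeMonoid.of k * FreeMonoid.of i * FreeMonoid.of k)

/-- The positive braid monoid `Bₙ⁺`: the quotient of the free monoid on
`σ₁, …, σ_{n-1}` by the monoid congruence generated by the braid relations. -/
abbrev BraidMonoid (n : ℕ) : Type := (conGen (BraidMonoidRel n)).Quotient

/-- The generator `σᵢ` of the positive braid monoid `Bₙ⁺`. -/
def braidMonoidGen (n : ℕ) (i : Fin (n - 1)) : BraidMonoid n :=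
  (conGen (BraidMonoidRel n)).mk' (FreeMonoid.of i)


/-- The generator `σ_{i+1}` of `Bₙ⁺` for a natural-number index `i < n - 1`
(junk value `1` otherwise). -/
def sigmaPlus (n : ℕ) (i : ℕ) : BraidMonoid n :=
  if h : i < n - 1 then braidMonoidGen n ⟨i, h⟩ else 1

/-- The Garside element `Δₙ = (σ_{n-1} ⋯ σ₁)(σ_{n-1} ⋯ σ₂) ⋯ (σ_{n-1})` of the
positive braid monoid `Bₙ⁺`. -/
def deltaPlus (n : ℕ) : BraidMonoid n :=
  ((List.range (n - 1)).map fun k =>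
    ((List.range (n - 1 - k)).map fun j => sigmaPlus n (n - 2 - j)).prod).prod

namespace BraidMonoid

variable {n : ℕ}

/-- The left endpoint of the adjacent transposition with index `i`. -/
def lo (i : Fin (n - 1)) : Fin n := ⟨i, lt_of_lt_of_le i.isLt (Nat.sub_le n 1)⟩

lemma succ_lt (i : Fin (n - 1)) : (i : ℕ) + 1 < n := by
  have h := i.isLt
  omega

/-- The right endpoint of the adjacent transposition with index `i`. -/
def hi (i : Fin (n - 1)) : Fin n := ⟨i + 1, succ_lt i⟩

/-- The adjacent transposition with index `i`. -/
def adjSwap (i : Fin (n - 1)) : Equiv.Perm (Fin n) := Equiv.swap (lo i) (hi i)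

lemma adjSwap_apply_val (i : Fin (n - 1)) (a : Fin n) :
    (adjSwap i a : ℕ) =
      if (a : ℕ) = i then (i : ℕ) + 1 else if (a : ℕ) = i + 1 then (i : ℕ) else a := by
  simp only [adjSwap, Equiv.swap_apply_def, lo, hi, Fin.ext_iff]
  split_ifs <;> rfl

@[simp]
lemma adjSwap_mul_self (i : Fin (n - 1)) : adjSwap i * adjSwap i = 1 :=
  Equiv.swap_mul_self _ _

@[simp]
lemma mul_adjSwap_mul_adjSwap (w : Equiv.Perm (Fin n)) (i : Fin (n - 1)) :
    w * adjSwap i * adjSwap i = w := by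
  rw [mul_assoc, adjSwap_mul_self, mul_one]

@[simp]
lemma adjSwap_lo (i : Fin (n - 1)) : adjSwap i (lo i) = hi i := Equiv.swap_apply_left _ _

@[simp]
lemma adjSwap_hi (i : Fin (n - 1)) : adjSwap i (hi i) = lo i := Equiv.swap_apply_right _ _

@[simp]
lemma adjSwap_adjSwap (i : Fin (n - 1)) (a : Fin n) : adjSwap i (adjSwap i a) = a :=
  DFunLike.congr_fun (adjSwap_mul_self i) a

lemma lo_lt_hi (i : Fin (n - 1)) : lo i < hi i := Nat.lt_succ_self _

lemma adjSwap_comm {i k : Fin (n - 1)} (h : (i : ℕ) + 2 ≤ k) :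
    adjSwap i * adjSwap k = adjSwap k * adjSwap i := by
  ext a
  simp only [Equiv.Perm.mul_apply, adjSwap_apply_val]
  split_ifs <;> omega

lemma adjSwap_braid {i k : Fin (n - 1)} (h : (i : ℕ) + 1 = k) :
    adjSwap i * adjSwap k * adjSwap i = adjSwap k * adjSwap i * adjSwap k := by
  have e : lo k = hi i := Fin.ext h.symm
  have h1 : lo i ≠ hi i := (lo_lt_hi i).ne
  have h2 : hi i ≠ hi k := e ▸ (lo_lt_hi k).ne
  have h3 : lo i ≠ hi k := ((lo_lt_hi i).trans (e ▸ lo_lt_hi k)).ne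
  simp only [adjSwap, e]
  rw [Equiv.swap_mul_swap_mul_swap h1 h3, Equiv.swap_comm (lo i), Equiv.swap_comm (hi i) (hi k),
    Equiv.swap_mul_swap_mul_swap h2.symm h3.symm, Equiv.swap_comm]

/-- The set of inversions of a permutation. -/
def inversions (w : Equiv.Perm (Fin n)) : Finset (Fin n × Fin n) :=
  {x | x.1 < x.2 ∧ w x.2 < w x.1}

lemma mem_inversions {w : Equiv.Perm (Fin n)} {x : Fin n × Fin n} :
    x ∈ inversions w ↔ x.1 < x.2 ∧ w x.2 < w x.1 := by
  simp [inversions]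

/-- The number of inversions of a permutation. -/
def inv (w : Equiv.Perm (Fin n)) : ℕ := (inversions w).card

lemma inv_one : inv (1 : Equiv.Perm (Fin n)) = 0 := by
  simp only [inv, inversions, Finset.card_eq_zero, Finset.filter_eq_empty_iff]
  rintro x - ⟨h, h'⟩
  exact lt_asymm h h'

lemma inv_le (w : Equiv.Perm (Fin n)) : inv w ≤ n * n := by
  simpa [inv] using Finset.card_le_univ (inversions w)

lemma adjSwap_lt_adjSwap {i : Fin (n - 1)} {a b : Fin n} (hab : a < b)
    (h : ¬ (a = lo i ∧ b = hi i)) : adjSwap i a < adjSwap i b := by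
  simp only [Fin.lt_def, adjSwap_apply_val, lo, hi, Fin.ext_iff] at *
  split_ifs <;> omega

lemma inversions_mul_adjSwap {w : Equiv.Perm (Fin n)} {i : Fin (n - 1)}
    (h : w (lo i) < w (hi i)) :
    inversions (w * adjSwap i) =
      insert (lo i, hi i)
        ((inversions w).map ((adjSwap i).prodCongr (adjSwap i)).toEmbedding) := by
  ext ⟨a, b⟩
  simp only [mem_inversions, Finset.mem_insert,
    Finset.mem_map_equiv, Equiv.Perm.mul_apply, Prod.mk.injEq, Equiv.prodCongr_symm,
    Equiv.prodCongr_apply, Prod.map_apply, show (adjSwap i).symm = adjSwap i from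
      Equiv.symm_swap _ _]
  by_cases hx : a = lo i ∧ b = hi i
  · obtain ⟨rfl, rfl⟩ := hx
    simp [lo_lt_hi, h]
  · simp only [hx, false_or]
    refine and_congr_left fun hw => ⟨fun hab => adjSwap_lt_adjSwap hab hx, fun hab => ?_⟩
    have := adjSwap_lt_adjSwap (i := i) hab
    simp only [adjSwap_adjSwap] at this
    refine this ?_
    rintro ⟨h1, h2⟩
    rw [h1, h2] at hw
    exact lt_asymm h hw

lemma inv_mul_adjSwap_of_lt {w : Equiv.Perm (Fin n)} {i : Fin (n - 1)}
    (h : w (lo i) < w (hi i)) : inv (w * adjSwap i) = inv w + 1 := by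
  rw [inv, inversions_mul_adjSwap h, Finset.card_insert_of_notMem, Finset.card_map, inv]
  simp only [mem_inversions, Finset.mem_map_equiv,
    Equiv.prodCongr_symm, Equiv.prodCongr_apply, Prod.map_apply,
    show (adjSwap i).symm = adjSwap i from Equiv.symm_swap _ _, adjSwap_lo, adjSwap_hi]
  exact fun h' => lt_asymm h'.1 (lo_lt_hi i)

lemma inv_mul_adjSwap_of_gt {w : Equiv.Perm (Fin n)} {i : Fin (n - 1)}
    (h : w (hi i) < w (lo i)) : inv (w * adjSwap i) + 1 = inv w := by
  rw [← inv_mul_adjSwap_of_lt (i := i) (by simpa using h), mul_adjSwap_mul_adjSwap]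

lemma lt_or_gt (w : Equiv.Perm (Fin n)) (i : Fin (n - 1)) :
    w (lo i) < w (hi i) ∨ w (hi i) < w (lo i) :=
  lt_or_gt_of_ne (w.injective.ne (lo_lt_hi i).ne)

lemma eq_one_of_forall_lt {w : Equiv.Perm (Fin n)} (h : ∀ i, w (lo i) < w (hi i)) : w = 1 := by
  cases n with
  | zero => exact Subsingleton.elim _ _
  | succ m =>
    have hw : StrictMono w := Fin.strictMono_iff_lt_succ.2 h
    exact Equiv.ext fun a => congrFun
      ((hw.range_inj strictMono_id).1 (by simp [w.surjective.range_eq])) a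

lemma eq_revPerm_of_forall_gt {w : Equiv.Perm (Fin n)} (h : ∀ i, w (hi i) < w (lo i)) :
    w = Fin.revPerm := by
  have : Fin.revPerm * w = 1 := eq_one_of_forall_lt fun i => by simpa using h i
  rw [eq_inv_of_mul_eq_one_right this]
  rfl

lemma inv_revPerm : inv (Fin.revPerm : Equiv.Perm (Fin n)) = ∑ k ∈ Finset.range n, (n - 1 - k) := by
  have : inversions (Fin.revPerm : Equiv.Perm (Fin n)) = ({x | x.1 < x.2} : Finset _) := by
    ext x; simp [inversions]
  rw [inv, this, Finset.card_filter, Fintype.sum_prod_type, Finset.sum_range]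
  refine Finset.sum_congr rfl fun a _ => ?_
  rw [← Finset.card_filter, ← Fin.card_Ioi]
  congr 1
  ext; simp

/-- The homomorphism from the positive braid monoid to the symmetric group. -/
def toPerm (n : ℕ) : BraidMonoid n →* Equiv.Perm (Fin n) :=
  Con.lift _ (FreeMonoid.lift adjSwap) <| by
    refine Con.conGen_le.2 fun x y hxy => ?_
    cases hxy with
    | comm i k h => simpa [Con.ker_rel] using adjSwap_comm h
    | braid i k h => simpa [Con.ker_rel] using adjSwap_braid h

/-- The word length on the positive braid monoid, as a homomorphism. -/
def lengthHom (n : ℕ) : BraidMonoid n →* Multiplicative ℕ :=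
  Con.lift _ (FreeMonoid.lift fun _ => Multiplicative.ofAdd 1) <| by
    refine Con.conGen_le.2 fun x y hxy => ?_
    cases hxy <;> simp [Con.ker_rel]

/-- The word length of a positive braid. -/
def length (p : BraidMonoid n) : ℕ := (lengthHom n p).toAdd

@[simp]
lemma toPerm_gen (i : Fin (n - 1)) : toPerm n (braidMonoidGen n i) = adjSwap i := rfl

@[simp]
lemma length_one : length (1 : BraidMonoid n) = 0 := by simp [length]

@[simp]
lemma length_mul (p q : BraidMonoid n) : length (p * q) = length p + length q := by
  simp [length]

@[simp]
lemma length_gen (i : Fin (n - 1)) : length (braidMonoidGen n i) = 1 := rfl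

lemma gen_comm {i k : Fin (n - 1)} (h : (i : ℕ) + 2 ≤ k) :
    braidMonoidGen n i * braidMonoidGen n k = braidMonoidGen n k * braidMonoidGen n i :=
  (Con.eq _).2 (ConGen.Rel.of _ _ (.comm i k h))

lemma gen_braid {i k : Fin (n - 1)} (h : (i : ℕ) + 1 = k) :
    braidMonoidGen n i * braidMonoidGen n k * braidMonoidGen n i =
      braidMonoidGen n k * braidMonoidGen n i * braidMonoidGen n k :=
  (Con.eq _).2 (ConGen.Rel.of _ _ (.braid i k h))

lemma eq_one_or_exists_mul_gen (p : BraidMonoid n) :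
    p = 1 ∨ ∃ p' i, p = p' * braidMonoidGen n i := by
  induction p using Con.induction_on with
  | H x =>
    rcases List.eq_nil_or_concat x.toList with h | ⟨l, i, h⟩
    · exact Or.inl (congrArg _ (FreeMonoid.toList.injective h))
    · refine Or.inr ⟨((FreeMonoid.ofList l : FreeMonoid _) : BraidMonoid n), i, ?_⟩
      have : x = FreeMonoid.ofList l * FreeMonoid.of i :=
        FreeMonoid.toList.injective (by simpa using h)
      rw [this]; rfl

lemma induction_mul_gen {P : BraidMonoid n → Prop} (p : BraidMonoid n) (one : P 1)
    (mul_gen : ∀ p i, P p → P (p * braidMonoidGen n i)) : P p := by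
  induction hN : length p generalizing p with
  | zero =>
    rcases eq_one_or_exists_mul_gen p with rfl | ⟨p', i, rfl⟩
    · exact one
    · simp at hN
  | succ N ih =>
    rcases eq_one_or_exists_mul_gen p with rfl | ⟨p', i, rfl⟩
    · exact one
    · exact mul_gen _ _ (ih p' (by simpa using hN))

/-- A positive braid is reduced when its length is the number of inversions of the underlying
permutation. -/
def IsReduced (p : BraidMonoid n) : Prop := inv (toPerm n p) = length p

lemma inv_mul_adjSwap_le (w : Equiv.Perm (Fin n)) (i : Fin (n - 1)) :
    inv (w * adjSwap i) ≤ inv w + 1 := by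
  rcases lt_or_gt w i with h | h
  · exact (inv_mul_adjSwap_of_lt h).le
  · have := inv_mul_adjSwap_of_gt h
    omega

lemma inv_toPerm_le_length (p : BraidMonoid n) : inv (toPerm n p) ≤ length p := by
  induction p using induction_mul_gen with
  | one => simp [inv_one]
  | mul_gen p i ih =>
    have := inv_mul_adjSwap_le (toPerm n p) i
    simp only [map_mul, toPerm_gen, length_mul, length_gen]
    omega

lemma isReduced_one : IsReduced (1 : BraidMonoid n) := by simp [IsReduced, inv_one]

lemma IsReduced.of_mul_gen {p : BraidMonoid n} {i : Fin (n - 1)}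
    (h : IsReduced (p * braidMonoidGen n i)) : IsReduced p := by
  have h1 := inv_mul_adjSwap_le (toPerm n p) i
  have h2 := inv_toPerm_le_length p
  simp only [IsReduced, map_mul, toPerm_gen, length_mul, length_gen] at *
  omega

lemma IsReduced.of_mul {p q : BraidMonoid n} (h : IsReduced (p * q)) : IsReduced p := by
  induction q using induction_mul_gen with
  | one => simpa using h
  | mul_gen q i ih => exact ih (by rw [← mul_assoc] at h; exact h.of_mul_gen)

lemma IsReduced.mul_gen {p : BraidMonoid n} {i : Fin (n - 1)} (h : IsReduced p)
    (hi : toPerm n p (lo i) < toPerm n p (hi i)) : IsReduced (p * braidMonoidGen n i) := by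
  simp only [IsReduced, map_mul, toPerm_gen, length_mul, length_gen] at *
  rw [inv_mul_adjSwap_of_lt hi, h]

lemma IsReduced.descent {p : BraidMonoid n} {i : Fin (n - 1)}
    (h : IsReduced (p * braidMonoidGen n i)) :
    toPerm n (p * braidMonoidGen n i) (hi i) < toPerm n (p * braidMonoidGen n i) (lo i) := by
  simp only [map_mul, toPerm_gen, Equiv.Perm.mul_apply, adjSwap_lo, adjSwap_hi]
  refine (lt_or_gt (toPerm n p) i).resolve_right fun h' => ?_
  have h1 := inv_mul_adjSwap_of_gt h'
  have h2 := inv_toPerm_le_length p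
  simp only [IsReduced, map_mul, toPerm_gen, length_mul, length_gen] at h
  omega

lemma exists_isReduced (w : Equiv.Perm (Fin n)) : ∃ p, toPerm n p = w ∧ IsReduced p := by
  induction hN : inv w using Nat.strong_induction_on generalizing w with
  | _ N ih =>
    by_cases h : ∀ i, w (lo i) < w (hi i)
    · exact ⟨1, by rw [eq_one_of_forall_lt h, map_one], isReduced_one⟩
    · push Not at h
      obtain ⟨i, hle⟩ := h
      have hi := (lt_or_gt w i).resolve_left hle.not_gt
      have h1 := inv_mul_adjSwap_of_gt hi
      obtain ⟨p, hp, hr⟩ := ih _ (by omega) (w * adjSwap i) rfl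
      exact ⟨p * braidMonoidGen n i, by simp [hp], hr.mul_gen (by simpa [hp] using hi)⟩

lemma lo_eq_hi_of_succ {i k : Fin (n - 1)} (h : (i : ℕ) + 1 = k) : lo k = hi i :=
  Fin.ext h.symm

lemma adjSwap_apply_of_ne {i : Fin (n - 1)} {a : Fin n} (h1 : (a : ℕ) ≠ i)
    (h2 : (a : ℕ) ≠ i + 1) : adjSwap i a = a :=
  Fin.ext (by rw [adjSwap_apply_val, if_neg h1, if_neg h2])

/-- Reduced braids are determined by their underlying permutations (Matsumoto's theorem for the
symmetric group). -/
theorem IsReduced.eq_of_toPerm_eq {p q : BraidMonoid n} (hp : IsReduced p) (hq : IsReduced q)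
    (h : toPerm n p = toPerm n q) : p = q := by
  induction hN : length p using Nat.strong_induction_on generalizing p q with
  | _ N ih =>
    have hlen : length p = length q := by rw [← hp, ← hq, h]
    rcases eq_one_or_exists_mul_gen p with rfl | ⟨p', i, rfl⟩
    · rcases eq_one_or_exists_mul_gen q with rfl | ⟨q', j, rfl⟩
      · rfl
      · simp at hlen
    rcases eq_one_or_exists_mul_gen q with rfl | ⟨q', j, rfl⟩
    · simp at hlen
    wlog hij : (i : ℕ) ≤ j generalizing i j p' q'
    · exact (this q' j hq (hlen ▸ hN) p' i hp h.symm hlen.symm (by omega)).symm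
    have hdi := hp.descent
    have hdj := hq.descent
    rw [← h] at hdj
    set w := toPerm n (p' * braidMonoidGen n i) with hw
    have hp' : toPerm n p' = w * adjSwap i := by simp [hw]
    have hq' : toPerm n q' = w * adjSwap j := by simp [h]
    simp only [length_mul, length_gen] at hN hlen
    rcases hij.eq_or_lt with hij | hij
    · obtain rfl := Fin.ext hij
      rw [ih _ (by omega) hp.of_mul_gen hq.of_mul_gen (hp'.trans hq'.symm) rfl]
    rcases Nat.lt_or_ge ((i : ℕ) + 1) j with hij | hji
    · obtain ⟨r, hr, hrr⟩ := exists_isReduced (w * adjSwap i * adjSwap j)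
      have ei_lo : adjSwap i (lo j) = lo j :=
        adjSwap_apply_of_ne (by simp [lo]; omega) (by simp [lo]; omega)
      have ei_hi : adjSwap i (hi j) = hi j :=
        adjSwap_apply_of_ne (by simp [hi]; omega) (by simp [hi]; omega)
      have ej_lo : adjSwap j (lo i) = lo i :=
        adjSwap_apply_of_ne (by simp [lo]; omega) (by simp [lo]; omega)
      have ej_hi : adjSwap j (hi i) = hi i :=
        adjSwap_apply_of_ne (by simp [hi]; omega) (by simp [hi]; omega)
      have h1 : p' = r * braidMonoidGen n j :=
        ih _ (by omega) hp.of_mul_gen (hrr.mul_gen (by simpa [hr, ei_lo, ei_hi] using hdj))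
          (by simp [hp', hr]) rfl
      have h2 : q' = r * braidMonoidGen n i :=
        ih _ (by omega) hq.of_mul_gen
          (hrr.mul_gen (by simpa [hr, ej_lo, ej_hi] using hdi))
          (by rw [map_mul, hr, hq', mul_assoc w, adjSwap_comm hij, ← mul_assoc, toPerm_gen,
            mul_adjSwap_mul_adjSwap]) rfl
      rw [h1, h2, mul_assoc, mul_assoc, gen_comm hij]
    · have hij : (i : ℕ) + 1 = j := by omega
      obtain ⟨r, hr, hrr⟩ := exists_isReduced (w * adjSwap i * adjSwap j * adjSwap i)
      have e : lo j = hi i := lo_eq_hi_of_succ hij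
      have ei_hi : adjSwap i (hi j) = hi j :=
        adjSwap_apply_of_ne (by simp [hi]; omega) (by simp [hi]; omega)
      have ej_lo : adjSwap j (lo i) = lo i :=
        adjSwap_apply_of_ne (by simp [lo]; omega) (by simp [lo]; omega)
      have ej_hi : adjSwap j (hi i) = hi j := by rw [← e, adjSwap_lo]
      rw [e] at hdj
      have hr' : toPerm n r = w * adjSwap j * adjSwap i * adjSwap j := by
        rw [hr, mul_assoc w, mul_assoc w, adjSwap_braid hij]; simp only [mul_assoc]
      have ri : IsReduced (r * braidMonoidGen n i) :=
        hrr.mul_gen (by simpa [hr, ej_lo, ej_hi, ei_hi] using hdj)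
      have rj : IsReduced (r * braidMonoidGen n j) :=
        hrr.mul_gen (by simpa [hr', e, ej_lo, ej_hi, ei_hi] using hdi)
      have h1 : p' = r * braidMonoidGen n i * braidMonoidGen n j :=
        ih _ (by omega) hp.of_mul_gen
          (ri.mul_gen (by simpa [hr, e, ej_lo, ej_hi, ei_hi] using hdj.trans hdi))
          (by simp [hp', hr]) rfl
      have h2 : q' = r * braidMonoidGen n j * braidMonoidGen n i :=
        ih _ (by omega) hq.of_mul_gen
          (rj.mul_gen (by simpa [hr', e, ej_lo, ej_hi, ei_hi] using hdj.trans hdi))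
          (by simp [hq', hr']) rfl
      rw [h1, h2, mul_assoc, mul_assoc, mul_assoc r, mul_assoc r, ← mul_assoc (braidMonoidGen n i),
        gen_braid hij, mul_assoc (braidMonoidGen n j)]

/-- Every reduced braid extends on the right to a reduced lift of the longest permutation. -/
lemma IsReduced.exists_mul {p : BraidMonoid n} (hp : IsReduced p) :
    ∃ q, toPerm n (p * q) = Fin.revPerm ∧ IsReduced (p * q) := by
  induction hN : n * n - length p using Nat.strong_induction_on generalizing p with
  | _ N ih =>
    by_cases h : ∀ i, toPerm n p (hi i) < toPerm n p (lo i)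
    · exact ⟨1, by rw [mul_one, eq_revPerm_of_forall_gt h], by rwa [mul_one]⟩
    · push Not at h
      obtain ⟨i, hle⟩ := h
      have hr := hp.mul_gen ((lt_or_gt _ i).resolve_right hle.not_gt)
      have hn := inv_le (toPerm n (p * braidMonoidGen n i))
      rw [hr, length_mul, length_gen] at hn
      obtain ⟨q, hq⟩ := ih _ (by rw [length_mul, length_gen]; omega) hr rfl
      exact ⟨braidMonoidGen n i * q, by rwa [← mul_assoc]⟩

lemma sigmaPlus_eq {i : ℕ} (h : i < n - 1) : sigmaPlus n i = braidMonoidGen n ⟨i, h⟩ := dif_pos h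

lemma length_prod_sigmaPlus {m : ℕ} (hm : m ≤ n - 1) :
    length ((List.range m).map fun j => sigmaPlus n (n - 2 - j)).prod = m := by
  induction m with
  | zero => simp
  | succ m ih =>
    simp [List.range_succ, ih (by omega), sigmaPlus_eq (show n - 2 - m < n - 1 by omega)]

lemma length_deltaPlus : length (deltaPlus n) = ∑ k ∈ Finset.range n, (n - 1 - k) := by
  have key (m : ℕ) : length ((List.range m).map fun k =>
      ((List.range (n - 1 - k)).map fun j => sigmaPlus n (n - 2 - j)).prod).prod =
        ∑ k ∈ Finset.range m, (n - 1 - k) := by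
    induction m with
    | zero => simp
    | succ m ih =>
      simp [List.range_succ, ih, Finset.sum_range_succ,
        length_prod_sigmaPlus (Nat.sub_le (n - 1) m)]
  rw [deltaPlus, key]
  cases n with
  | zero => rfl
  | succ m => simp [Finset.sum_range_succ]

lemma toPerm_prod_sigmaPlus_apply {m : ℕ} (hm : m ≤ n - 1) (a : Fin n) :
    (toPerm n ((List.range m).map fun j => sigmaPlus n (n - 2 - j)).prod a : ℕ) =
      if (a : ℕ) + m + 1 < n then (a : ℕ) else
        if (a : ℕ) + m + 1 = n then n - 1 else (a : ℕ) - 1 := by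
  induction m generalizing a with
  | zero =>
    have := a.isLt
    simp only [List.range_zero, List.map_nil, List.prod_nil, map_one, Equiv.Perm.one_apply]
    split_ifs <;> omega
  | succ m ih =>
    have := a.isLt
    simp only [List.range_succ, List.map_append, List.prod_append, List.map_singleton,
      List.prod_singleton, map_mul, Equiv.Perm.mul_apply, ih (by omega : m ≤ n - 1),
      sigmaPlus_eq (show n - 2 - m < n - 1 by omega), toPerm_gen, adjSwap_apply_val]
    split_ifs <;> omega

lemma toPerm_deltaPlus : toPerm n (deltaPlus n) = Fin.revPerm := by
  have key (m : ℕ) (hm : m ≤ n - 1) (a : Fin n) : (toPerm n ((List.range m).map fun k =>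
      ((List.range (n - 1 - k)).map fun j => sigmaPlus n (n - 2 - j)).prod).prod a : ℕ) =
        if (a : ℕ) < m then n - 1 - (a : ℕ) else (a : ℕ) - m := by
    induction m generalizing a with
    | zero => simp
    | succ m ih =>
      have := a.isLt
      simp only [List.range_succ, List.map_append, List.prod_append, List.map_singleton,
        List.prod_singleton, map_mul, Equiv.Perm.mul_apply, ih (by omega),
        toPerm_prod_sigmaPlus_apply (Nat.sub_le (n - 1) m)]
      split_ifs <;> omega
  ext a
  have := a.isLt
  rw [deltaPlus, key _ le_rfl, Fin.revPerm_apply, Fin.val_rev]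
  split_ifs <;> omega

lemma isReduced_deltaPlus : IsReduced (deltaPlus n) := by
  rw [IsReduced, toPerm_deltaPlus, inv_revPerm, length_deltaPlus]

theorem bijOn_toPerm :
    Set.BijOn (toPerm n) {p : BraidMonoid n | ∃ q : BraidMonoid n, p * q = deltaPlus n}
      Set.univ := by
  refine ⟨Set.mapsTo_univ _ _, ?_, ?_⟩
  · rintro p ⟨q, hq⟩ p' ⟨q', hq'⟩ h
    have hp : IsReduced (p * q) := hq ▸ isReduced_deltaPlus
    have hp' : IsReduced (p' * q') := hq' ▸ isReduced_deltaPlus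
    exact hp.of_mul.eq_of_toPerm_eq hp'.of_mul h
  · rintro w -
    obtain ⟨p, rfl, hp⟩ := exists_isReduced w
    obtain ⟨q, hq, hr⟩ := hp.exists_mul
    exact ⟨p, ⟨q, hr.eq_of_toPerm_eq isReduced_deltaPlus (hq.trans toPerm_deltaPlus.symm)⟩, rfl⟩

end BraidMonoid

/-- The left divisors of the Garside element `Δₙ` in `Bₙ⁺` (the permutation braids)
are in bijective correspondence with the symmetric group `Σₙ`: the monoid homomorphism
`π : Bₙ⁺ → Σₙ` with `σᵢ ↦ (i, i+1)` restricts to a bijection from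
`{p ∈ Bₙ⁺ : p q = Δₙ for some q ∈ Bₙ⁺}` onto `Σₙ`; in particular `Δₙ` has exactly
`n!` left divisors in `Bₙ⁺`. -/
theorem permutation_braids_biject_with_symmetric_group (n : ℕ) :
    ∃ π : BraidMonoid n →* Equiv.Perm (Fin n),
      (∀ i : Fin (n - 1),
        π (braidMonoidGen n i) =
          Equiv.swap (⟨(i : ℕ), lt_of_lt_of_le i.isLt (Nat.sub_le n 1)⟩ : Fin n)
            (⟨(i : ℕ) + 1, by have h := i.isLt; omega⟩ : Fin n)) ∧
      Set.BijOn π {p : BraidMonoid n | ∃ q : BraidMonoid n, p * q = deltaPlus n}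
        Set.univ ∧
      Nat.card {p : BraidMonoid n | ∃ q : BraidMonoid n, p * q = deltaPlus n} =
        Nat.factorial n := by
  refine ⟨BraidMonoid.toPerm n, fun i => rfl, BraidMonoid.bijOn_toPerm, ?_⟩
  rw [Nat.card_congr BraidMonoid.bijOn_toPerm.equiv, Nat.card_univ, Nat.card_perm, Nat.card_fin]
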